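/- arXiv:2008.11268 — 3 statements merged into one kernel-verified Lean document; each statement's English description precedes it below -/
import Mathlib

section
/- If h is a minimal vanishing sorou, then the relative order of h is squarefree (equivalently, it is a product of distinct primes). -/
open Complex

noncomputable def nu (n : ℕ) : ℂ := Complex.exp (2 * Real.pi * Complex.I / n)

def IsRootOfUnity (z : ℂ) : Prop := ∃ n : ℕ, 0 < n ∧ z ^ n = 1

def IsSorou (h : Multiset ℂ) : Prop := h ≠ 0 ∧ ∀ z ∈ h, IsRootOfUnity z

noncomputable def rootOrder (z : ℂ) : ℕ := sInf {d : ℕ | 0 < d ∧ z ^ d = 1}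

noncomputable def sorouOrder (h : Multiset ℂ) : ℕ := (h.map rootOrder).lcm

noncomputable def relOrder (h : Multiset ℂ) : ℕ :=
  (h.bind fun a => h.map fun b => rootOrder (a / b)).lcm

def IsMinVanishing (h : Multiset ℂ) : Prop :=
  h.sum = 0 ∧ ∀ g : Multiset ℂ, g ≤ h → g ≠ 0 → g ≠ h → g.sum ≠ 0

theorem rootOrder_eq_orderOf (z : ℂ) : rootOrder z = orderOf z := by
  unfold rootOrder
  by_cases hz : IsOfFinOrder z
  · apply le_antisymm
    · exact Nat.sInf_le ⟨hz.orderOf_pos, pow_orderOf_eq_one z⟩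
    · have hne : {d : ℕ | 0 < d ∧ z ^ d = 1}.Nonempty :=
        ⟨orderOf z, hz.orderOf_pos, pow_orderOf_eq_one z⟩
      obtain ⟨h0, h1⟩ := Nat.sInf_mem hne
      exact orderOf_le_of_pow_eq_one h0 h1
  · rw [orderOf_eq_zero hz, Nat.sInf_eq_zero]
    right
    rw [Set.eq_empty_iff_forall_notMem]
    rintro d ⟨h0, h1⟩
    exact hz (isOfFinOrder_iff_pow_eq_one.mpr ⟨d, h0, h1⟩)

theorem IsRootOfUnity.isOfFinOrder {z : ℂ} (hz : IsRootOfUnity z) : IsOfFinOrder z :=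
  isOfFinOrder_iff_pow_eq_one.mpr hz

theorem IsRootOfUnity.div {a b : ℂ} (ha : IsRootOfUnity a) (hb : IsRootOfUnity b) :
    IsRootOfUnity (a / b) := by
  obtain ⟨m, hm, ham⟩ := ha
  obtain ⟨n, hn, hbn⟩ := hb
  refine ⟨m * n, Nat.mul_pos hm hn, ?_⟩
  rw [div_pow, pow_mul, ham, mul_comm m n, pow_mul, hbn]
  simp

theorem IsRootOfUnity.ne_zero {a : ℂ} (ha : IsRootOfUnity a) : a ≠ 0 := by
  rintro rfl
  obtain ⟨n, hn, h⟩ := ha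
  simp [hn.ne'] at h

theorem relOrder_dvd_iff (h : Multiset ℂ) (d : ℕ) :
    relOrder h ∣ d ↔ ∀ a ∈ h, ∀ b ∈ h, (a / b) ^ d = 1 := by
  simp only [relOrder, Multiset.lcm_dvd, Multiset.mem_bind, Multiset.mem_map,
    rootOrder_eq_orderOf]
  constructor
  · intro H a ha b hb
    exact orderOf_dvd_iff_pow_eq_one.mp (H _ ⟨a, ha, b, hb, rfl⟩)
  · rintro H _ ⟨a, ha, b, hb, rfl⟩
    exact orderOf_dvd_iff_pow_eq_one.mpr (H a ha b hb)

theorem IsSorou.relOrder_pos {h : Multiset ℂ} (hs : IsSorou h) : 0 < relOrder h := by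
  rw [Nat.pos_iff_ne_zero, relOrder, Ne, Multiset.lcm_eq_zero_iff]
  simp only [Multiset.mem_bind, Multiset.mem_map, rootOrder_eq_orderOf]
  rintro ⟨a, ha, b, hb, hab⟩
  exact ((hs.2 a ha).div (hs.2 b hb)).isOfFinOrder.orderOf_pos.ne' hab

/-- Rational relations between powers of a primitive root hold for all its conjugates. -/
theorem sum_pow_eq_zero_of_isPrimitiveRoot {n : ℕ} (hn : 0 < n) {ζ ξ : ℂ}
    (hζ : IsPrimitiveRoot ζ n) (hξ : IsPrimitiveRoot ξ n) (s : Multiset ℕ)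
    (h : (s.map (ζ ^ ·)).sum = 0) : (s.map (ξ ^ ·)).sum = 0 := by
  have key (x : ℂ) : Polynomial.aeval x (s.map fun k => (Polynomial.X : Polynomial ℚ) ^ k).sum
      = (s.map (x ^ ·)).sum := by
    rw [map_multiset_sum, Multiset.map_map]
    simp
  rw [← key] at h ⊢
  have hmin : minpoly ℚ ζ = minpoly ℚ ξ := by
    rw [← Polynomial.cyclotomic_eq_minpoly_rat hζ hn,
      ← Polynomial.cyclotomic_eq_minpoly_rat hξ hn]
  exact Polynomial.aeval_eq_zero_of_dvd_aeval_eq_zero (hmin ▸ minpoly.dvd ℚ ζ h)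
    (minpoly.aeval ℚ ξ)

/-- The terms of a vanishing sum of `n`-th roots of unity with exponent divisible by `p`
form a vanishing sum when `p ^ 2 ∣ n`. -/
theorem sum_pow_filter_dvd_eq_zero {m p : ℕ} (hp : p.Prime) (hm : 0 < m) (hpm : p ∣ m) {ζ : ℂ}
    (hζ : IsPrimitiveRoot ζ (p * m)) (s : Multiset ℕ) (h : (s.map (ζ ^ ·)).sum = 0) :
    ((s.filter (p ∣ ·)).map (ζ ^ ·)).sum = 0 := by
  have hpos : 0 < p * m := Nat.mul_pos hp.pos hm
  have hω : IsPrimitiveRoot (ζ ^ m) p := hζ.pow hpos (mul_comm p m)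
  have hconj (j : ℕ) : (s.map fun k => (ζ ^ (1 + j * m)) ^ k).sum = 0 := by
    refine sum_pow_eq_zero_of_isPrimitiveRoot hpos hζ (hζ.pow_of_coprime _ ?_) s h
    have h1 : (1 + j * m).Coprime m := by simp
    exact (h1.coprime_dvd_right hpm).mul_right h1
  have hgeom (k : ℕ) : ∑ j ∈ Finset.range p, (ζ ^ (1 + j * m)) ^ k
      = if p ∣ k then p * ζ ^ k else 0 := by
    have hterm (j : ℕ) : (ζ ^ (1 + j * m)) ^ k = ζ ^ k * ((ζ ^ m) ^ k) ^ j := by ring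
    simp only [hterm, ← Finset.mul_sum]
    split_ifs with hk
    · rw [(hω.pow_eq_one_iff_dvd k).mpr hk]
      simp [mul_comm]
    · have hne : (ζ ^ m) ^ k ≠ 1 := fun h1 => hk ((hω.pow_eq_one_iff_dvd k).mp h1)
      rw [geom_sum_eq hne, ← pow_mul, mul_comm k p, pow_mul, hω.pow_eq_one]
      simp
  have hsum : (p : ℂ) * ((s.filter (p ∣ ·)).map (ζ ^ ·)).sum = 0 := by
    calc (p : ℂ) * ((s.filter (p ∣ ·)).map (ζ ^ ·)).sum
        = (s.map fun k => ∑ j ∈ Finset.range p, (ζ ^ (1 + j * m)) ^ k).sum := by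
          simp only [hgeom]
          clear h hconj
          induction s using Multiset.induction_on with
          | empty => simp
          | cons a s ih =>
            by_cases ha : p ∣ a <;> simp [ha, mul_add, ih]
      _ = ∑ j ∈ Finset.range p, (s.map fun k => (ζ ^ (1 + j * m)) ^ k).sum :=
          Multiset.sum_map_sum_map s (Finset.range p).val
      _ = 0 := Finset.sum_eq_zero fun j _ => hconj j
  exact (mul_eq_zero.mp hsum).resolve_left (Nat.cast_ne_zero.mpr hp.ne_zero)

theorem stmt_0 (h : Multiset ℂ) (hs : IsSorou h) (hmv : IsMinVanishing h) :
    Squarefree (relOrder h) := by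
  rw [Nat.squarefree_iff_prime_squarefree]
  rintro p hp ⟨c, hc⟩
  have hpos := hs.relOrder_pos
  obtain ⟨a₀, ha₀⟩ := Multiset.exists_mem_of_ne_zero hs.1
  have ha₀ne : a₀ ≠ 0 := (hs.2 a₀ ha₀).ne_zero
  set m := p * c with hm_def
  have hn : relOrder h = p * m := by rw [hc, hm_def, mul_assoc]
  have hm : 0 < m := Nat.pos_of_mul_pos_left (hn ▸ hpos)
  have : NeZero (p * m) := ⟨hn ▸ hpos.ne'⟩
  obtain ⟨ζ, hζ⟩ : ∃ ζ : ℂ, IsPrimitiveRoot ζ (p * m) :=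
    ⟨_, Complex.isPrimitiveRoot_exp _ (NeZero.ne _)⟩
  have hdiv := (relOrder_dvd_iff h (p * m)).mp hn.dvd
  have hex (a : ℂ) : ∃ k : ℕ, a ∈ h → ζ ^ k = a / a₀ := by
    by_cases ha : a ∈ h
    · obtain ⟨k, -, hk⟩ := hζ.eq_pow_of_pow_eq_one (hdiv a ha a₀ ha₀)
      exact ⟨k, fun _ => hk⟩
    · exact ⟨0, fun h' => absurd h' ha⟩
  choose f hf using hex
  have hsum (g : Multiset ℂ) (hg : g ≤ h) : ((g.map f).map (ζ ^ ·)).sum = g.sum / a₀ := by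
    have hmap : (g.map f).map (ζ ^ ·) = g.map (· / a₀) := by
      rw [Multiset.map_map]
      exact Multiset.map_congr rfl fun a ha => hf a (Multiset.mem_of_le hg ha)
    rw [hmap, Multiset.sum_map_div, Multiset.map_id']
  have hfilter : h.filter (fun a => p ∣ f a) = h := by
    by_contra hne
    have hle : h.filter (fun a => p ∣ f a) ≤ h := Multiset.filter_le _ h
    refine hmv.2 _ hle ?_ hne ?_
    · have h0 : p ∣ f a₀ := by
        refine (Dvd.intro m rfl).trans ((hζ.pow_eq_one_iff_dvd _).mp ?_)
        rw [hf a₀ ha₀, div_self ha₀ne]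
      intro h1
      exact Multiset.notMem_zero a₀ (h1 ▸ Multiset.mem_filter.mpr ⟨ha₀, h0⟩)
    · have h1 := sum_pow_filter_dvd_eq_zero hp hm (Dvd.intro c rfl) hζ (h.map f)
        (by rw [hsum h le_rfl, hmv.1, zero_div])
      rw [Multiset.filter_map] at h1
      exact (div_eq_zero_iff.mp ((hsum _ hle).symm.trans h1)).resolve_right ha₀ne
  have hpow (a : ℂ) (ha : a ∈ h) : (a / a₀) ^ m = 1 := by
    obtain ⟨d, hd⟩ := Multiset.filter_eq_self.mp hfilter a ha
    rw [← hf a ha, hd, ← pow_mul, hζ.pow_eq_one_iff_dvd]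
    exact ⟨d, by ring⟩
  have hdvd : relOrder h ∣ m := by
    rw [relOrder_dvd_iff]
    intro a ha b hb
    rw [← div_div_div_cancel_right₀ ha₀ne a b, div_pow, hpow a ha, hpow b hb, div_one]
  have hle := Nat.le_of_dvd hm hdvd
  rw [hn] at hle
  nlinarith [hp.two_le]
end

section
/- Let p be a prime, let m be a positive integer not divisible by p, and let f_0, …, f_{p−1} be sorou each of whose elements is an m-th root of unity. Form the sorou h as the multiset sum of the rotations ν_p^j·f_j for j = 0, …, p−1, and assume h vanishes (equivalently, val(f_0) = val(f_1) = ⋯ = val(f_{p−1})). Then h is minimal vanishing if and only if: (i) val(f_0) ≠ 0; (ii) no f_j has a nonempty proper sub-multiset with sum 0; and (iii) there is no complex number z such that every f_j has a nonempty proper sub-multiset with sum z. -/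
open Complex

open Polynomial in
lemma IsPrimitiveRoot.totient_mul_totient_le_finrank_mul_finrank {K L : Type*} [Field K] [Field L]
    [Algebra ℚ K] [Algebra ℚ L] [Algebra K L] [IsScalarTower ℚ K L] [FiniteDimensional ℚ K]
    [FiniteDimensional K L] {p m : ℕ} (hp : 0 < p) (hm : 0 < m) (hcop : Nat.Coprime p m)
    {x y : L} (hx : IsPrimitiveRoot x p) (hy : IsPrimitiveRoot y m) :
    p.totient * m.totient ≤ Module.finrank ℚ K * Module.finrank K L := by
  have : FiniteDimensional ℚ L := FiniteDimensional.trans ℚ K L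
  rw [Module.finrank_mul_finrank, ← Nat.totient_mul hcop, ← hcop.lcm_eq_mul]
  exact hx.lcm_totient_le_finrank hy (cyclotomic.irreducible_rat (Nat.lcm_pos hp hm))

open Polynomial IntermediateField in
/-- If `K` is a number field of degree `φ m` containing a primitive `m`-th root of unity and `p` is
coprime to `m`, the `p`-th cyclotomic polynomial is the minimal polynomial over `K` of a primitive
`p`-th root of unity. -/
lemma IsPrimitiveRoot.minpoly_eq_cyclotomic_of_coprime {K E : Type*} [Field K] [Field E]
    [Algebra ℚ K] [Algebra K E] [FiniteDimensional ℚ K] {p m : ℕ} (hp : 0 < p) (hm : 0 < m)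
    (hcop : Nat.Coprime p m) {ζ : E} {ξ : K} (hζ : IsPrimitiveRoot ζ p)
    (hξ : IsPrimitiveRoot ξ m) (hrank : Module.finrank ℚ K = m.totient) :
    minpoly K ζ = cyclotomic p K := by
  have : CharZero K := algebraRat.charZero K
  have : CharZero E := charZero_of_injective_algebraMap (algebraMap K E).injective
  have hζint : IsIntegral K ζ := (hζ.isIntegral hp).tower_top
  have hroot : aeval ζ (cyclotomic p K) = 0 := by
    have := hζ.isRoot_cyclotomic hp
    rwa [← map_cyclotomic p (algebraMap K E), IsRoot.def, eval_map_algebraMap] at this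
  have hrank' : Module.finrank K K⟮ζ⟯ = (minpoly K ζ).natDegree :=
    IntermediateField.adjoin.finrank hζint
  have : FiniteDimensional K K⟮ζ⟯ := IntermediateField.adjoin.finiteDimensional hζint
  have hx : IsPrimitiveRoot (AdjoinSimple.gen K ζ) p :=
    IsPrimitiveRoot.of_map_of_injective (f := algebraMap K⟮ζ⟯ E) (by simpa using hζ)
      (algebraMap K⟮ζ⟯ E).injective
  have hy : IsPrimitiveRoot (algebraMap K K⟮ζ⟯ ξ) m :=
    hξ.map_of_injective (algebraMap K K⟮ζ⟯).injective
  have hle := hx.totient_mul_totient_le_finrank_mul_finrank (K := K) hp hm hcop hy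
  rw [hrank, hrank', mul_comm] at hle
  have hdeg : (cyclotomic p K).natDegree ≤ (minpoly K ζ).natDegree := by
    rw [natDegree_cyclotomic]
    exact le_of_mul_le_mul_left hle (Nat.totient_pos.2 hm)
  exact (eq_of_monic_of_dvd_of_natDegree_le (minpoly.monic hζint) (cyclotomic.monic p K)
    (minpoly.dvd K ζ hroot) hdeg).symm

open Polynomial IntermediateField in
/-- If `p` is coprime to `m`, the `p`-th cyclotomic polynomial is the minimal polynomial of a
primitive `p`-th root of unity over `ℚ(ξ)`, where `ξ` is a primitive `m`-th root of unity. -/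
lemma IsPrimitiveRoot.minpoly_adjoin_eq_cyclotomic {p m : ℕ} (hp : 0 < p) (hm : 0 < m)
    (hcop : Nat.Coprime p m) {ζ ξ : ℂ} (hζ : IsPrimitiveRoot ζ p) (hξ : IsPrimitiveRoot ξ m) :
    minpoly ℚ⟮ξ⟯ ζ = cyclotomic p ℚ⟮ξ⟯ := by
  have hξint : IsIntegral ℚ ξ := (hξ.isIntegral hm).tower_top
  have : FiniteDimensional ℚ ℚ⟮ξ⟯ := IntermediateField.adjoin.finiteDimensional hξint
  have hgen : IsPrimitiveRoot (AdjoinSimple.gen ℚ ξ) m :=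
    IsPrimitiveRoot.of_map_of_injective (f := algebraMap ℚ⟮ξ⟯ ℂ) (by simpa using hξ)
      (algebraMap ℚ⟮ξ⟯ ℂ).injective
  refine hζ.minpoly_eq_cyclotomic_of_coprime hp hm hcop hgen ?_
  rw [IntermediateField.adjoin.finrank hξint, ← cyclotomic_eq_minpoly_rat hξ hm,
    natDegree_cyclotomic]

open Polynomial IntermediateField in
/-- The only linear relations over `ℚ(ξ)` between the powers of a primitive `p`-th root of unity
are those with constant coefficients, if `ξ` is a primitive root of unity of order coprime
to `p`. -/
lemma IsPrimitiveRoot.coeff_eq_of_sum_pow_mul_eq_zero {p m : ℕ} (hp : p.Prime) (hm : 0 < m)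
    (hpm : ¬ p ∣ m) {ζ ξ : ℂ} (hζ : IsPrimitiveRoot ζ p) (hξ : IsPrimitiveRoot ξ m)
    {a : Fin p → ℂ} (ha : ∀ j, a j ∈ ℚ⟮ξ⟯) (hsum : ∑ j : Fin p, ζ ^ (j : ℕ) * a j = 0)
    (i j : Fin p) : a i = a j := by
  have := Fact.mk hp
  let b : Fin p → ℚ⟮ξ⟯ := fun j => ⟨a j, ha j⟩
  let Q : ℚ⟮ξ⟯[X] := ∑ j, C (b j) * X ^ (j : ℕ)
  have hcoeff (k : Fin p) : Q.coeff k = b k := by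
    simp [Q, finsetSum_coeff, coeff_C_mul, coeff_X_pow, Fin.val_inj]
  have hQ : aeval ζ Q = 0 := by
    rw [← hsum]
    simp only [Q, map_sum, map_mul, aeval_C, map_pow, aeval_X]
    exact Finset.sum_congr rfl fun k _ => mul_comm _ _
  have hdvd : cyclotomic p ℚ⟮ξ⟯ ∣ Q := by
    rw [← minpoly_adjoin_eq_cyclotomic hp.pos hm (hp.coprime_iff_not_dvd.2 hpm) hζ hξ]
    exact minpoly.dvd _ _ hQ
  have hdeg : Q.natDegree ≤ (cyclotomic p ℚ⟮ξ⟯).natDegree := by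
    rw [natDegree_cyclotomic, Nat.totient_prime hp]
    refine natDegree_sum_le_of_forall_le _ _ fun k _ => ?_
    exact (natDegree_C_mul_X_pow_le _ _).trans (Nat.le_sub_one_of_lt k.2)
  have hconst : Q = C Q.leadingCoeff * cyclotomic p ℚ⟮ξ⟯ :=
    eq_leadingCoeff_mul_of_monic_of_dvd_of_natDegree_le (cyclotomic.monic p _) hdvd hdeg
  have hcyc (k : Fin p) : (cyclotomic p ℚ⟮ξ⟯).coeff k = 1 := by
    simp [cyclotomic_prime, finsetSum_coeff, coeff_X_pow]
  have hb (k : Fin p) : b k = Q.leadingCoeff := by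
    conv_lhs => rw [← hcoeff, hconst, coeff_C_mul, hcyc, mul_one]
  exact congrArg Subtype.val ((hb i).trans (hb j).symm)

/-- A sub-multiset of a finite sum of multisets is a sum of sub-multisets of the summands. -/
lemma Multiset.exists_eq_sum_of_le_sum {ι α : Type*} (s : Finset ι) (F : ι → Multiset α)
    (g : Multiset α) (hg : g ≤ ∑ i ∈ s, F i) :
    ∃ G : ι → Multiset α, (∀ i, G i ≤ F i) ∧ g = ∑ i ∈ s, G i := by
  classical
  induction s using Finset.induction_on generalizing g with
  | empty => exact ⟨0, fun i => Multiset.zero_le _, by simpa using hg⟩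
  | insert a s has ih =>
    rw [Finset.sum_insert has] at hg
    obtain ⟨G, hG, hsum⟩ := ih (g - F a) (Multiset.sub_le_iff_le_add'.2 hg)
    refine ⟨Function.update G a (g ∩ F a), fun i => ?_, ?_⟩
    · rcases eq_or_ne i a with rfl | hi
      · simpa using Multiset.inter_le_right
      · simpa [hi] using hG i
    · rw [Finset.sum_insert has, Finset.sum_update_of_notMem has, ← hsum, Function.update_self,
        add_comm, Multiset.sub_add_inter]

lemma Multiset.sum_sum_map_pow_mul {p : ℕ} (ζ : ℂ) (g : Fin p → Multiset ℂ) :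
    (∑ j : Fin p, (g j).map (fun w => ζ ^ (j : ℕ) * w)).sum =
      ∑ j : Fin p, ζ ^ (j : ℕ) * (g j).sum := by
  rw [Multiset.sum_sum]
  exact Finset.sum_congr rfl fun j _ => Multiset.sum_map_mul_left.trans (by simp)

/-- If the multiset sum of the rotations `ζ ^ j • g j` vanishes, where the elements of all `g j`
are `m`-th roots of unity and `ζ` has prime order not dividing `m`, then all `g j` have the same
sum. -/
lemma IsPrimitiveRoot.sum_eq_sum_of_sum_rotation_eq_zero {p m : ℕ} (hp : p.Prime) (hm : 0 < m)
    (hpm : ¬ p ∣ m) {ζ : ℂ} (hζ : IsPrimitiveRoot ζ p) {g : Fin p → Multiset ℂ}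
    (hroots : ∀ j, ∀ z ∈ g j, z ^ m = 1)
    (hvan : (∑ j : Fin p, (g j).map (fun w => ζ ^ (j : ℕ) * w)).sum = 0) (i j : Fin p) :
    (g i).sum = (g j).sum := by
  rw [Multiset.sum_sum_map_pow_mul] at hvan
  have hξ := Complex.isPrimitiveRoot_exp m hm.ne'
  have := NeZero.of_pos hm
  refine hζ.coeff_eq_of_sum_pow_mul_eq_zero hp hm hpm hξ
    (fun k => multiset_sum_mem _ fun z hz => ?_) hvan i j
  obtain ⟨i, -, rfl⟩ := hξ.eq_pow_of_pow_eq_one (hroots k z hz)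
  exact pow_mem (IntermediateField.mem_adjoin_simple_self ℚ _) i

/-- A vanishing sum of rotations `ζ ^ j • f j` is minimal vanishing iff the only families of
sub-multisets of the `f j` with a common sum are the trivial ones. -/
lemma isMinVanishing_sum_rotation_iff {p m : ℕ} (hp : p.Prime) (hm : 0 < m) (hpm : ¬ p ∣ m)
    {ζ : ℂ} (hζ : IsPrimitiveRoot ζ p) (f : Fin p → Multiset ℂ)
    (hroots : ∀ j, ∀ z ∈ f j, z ^ m = 1)
    (hvan : (∑ j : Fin p, (f j).map (fun w => ζ ^ (j : ℕ) * w)).sum = 0) :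
    IsMinVanishing (∑ j : Fin p, (f j).map (fun w => ζ ^ (j : ℕ) * w)) ↔
      ∀ g : Fin p → Multiset ℂ, (∀ j, g j ≤ f j) → (∀ i j, (g i).sum = (g j).sum) →
        g = 0 ∨ g = f := by
  constructor
  · rintro ⟨-, hmin⟩ g hgf hg
    by_contra! hne
    obtain ⟨hg0, hgne⟩ := hne
    have hle (j : Fin p) (_ : j ∈ Finset.univ) :
        (g j).map (fun w => ζ ^ (j : ℕ) * w) ≤ (f j).map (fun w => ζ ^ (j : ℕ) * w) :=
      Multiset.map_le_map (hgf j)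
    refine hmin _ (Finset.sum_le_sum hle) ?_ ?_ ?_
    · intro h0
      refine hg0 (funext fun j => ?_)
      simpa using (Finset.sum_eq_zero_iff.1 h0) j (Finset.mem_univ j)
    · obtain ⟨j, hj⟩ := Function.ne_iff.1 hgne
      exact (Finset.sum_lt_sum hle ⟨j, Finset.mem_univ j,
        Multiset.map_lt_map (lt_of_le_of_ne (hgf j) hj)⟩).ne
    · rw [Multiset.sum_sum_map_pow_mul, Finset.sum_congr rfl fun j _ => by rw [hg j ⟨0, hp.pos⟩],
        ← Finset.sum_mul, Fin.sum_univ_eq_sum_range (fun j => ζ ^ j), hζ.geom_sum_eq_zero hp.one_lt, zero_mul]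
  · intro htriv
    refine ⟨hvan, fun k hk hk0 hkne hksum => ?_⟩
    obtain ⟨G, hG, rfl⟩ := Multiset.exists_eq_sum_of_le_sum _ _ k hk
    have hζ0 (j : Fin p) : ζ ^ (j : ℕ) ≠ 0 := pow_ne_zero _ (hζ.ne_zero hp.ne_zero)
    let g : Fin p → Multiset ℂ := fun j => (G j).map (fun w => (ζ ^ (j : ℕ))⁻¹ * w)
    have hgf (j : Fin p) : g j ≤ f j := by
      simpa [hζ0] using Multiset.map_le_map (f := fun w => (ζ ^ (j : ℕ))⁻¹ * w) (hG j)
    have hGg : G = fun j => (g j).map (fun w => ζ ^ (j : ℕ) * w) := by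
      funext j
      simp [g, hζ0]
    rw [hGg] at hksum hk0 hkne
    have hgroots (j : Fin p) (z : ℂ) (hz : z ∈ g j) : z ^ m = 1 :=
      hroots j z (Multiset.mem_of_le (hgf j) hz)
    rcases htriv g hgf (hζ.sum_eq_sum_of_sum_rotation_eq_zero hp hm hpm hgroots hksum)
      with h0 | hf
    · exact hk0 (by simp [h0])
    · exact hkne (by rw [hf])

theorem stmt_3 (p m : ℕ) (hp : p.Prime) (hm : 0 < m) (hpm : ¬ p ∣ m)
    (f : Fin p → Multiset ℂ) (hne : ∀ j, f j ≠ 0)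
    (hroots : ∀ j, ∀ z ∈ f j, z ^ m = 1)
    (h : Multiset ℂ) (hdef : h = ∑ j : Fin p, (f j).map (fun w => nu p ^ (j : ℕ) * w))
    (hvan : h.sum = 0) :
    IsMinVanishing h ↔
      ((f ⟨0, hp.pos⟩).sum ≠ 0 ∧
       (∀ j, ∀ g : Multiset ℂ, g ≤ f j → g ≠ 0 → g ≠ f j → g.sum ≠ 0) ∧
       ¬ ∃ z : ℂ, ∀ j, ∃ g : Multiset ℂ, g ≤ f j ∧ g ≠ 0 ∧ g ≠ f j ∧ g.sum = z) := by
  subst hdef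
  have hζ : IsPrimitiveRoot (nu p) p := Complex.isPrimitiveRoot_exp p hp.ne_zero
  have hiff := isMinVanishing_sum_rotation_iff hp hm hpm hζ f hroots hvan
  rw [hiff]
  have hsum : ∀ i j, (f i).sum = (f j).sum :=
    hζ.sum_eq_sum_of_sum_rotation_eq_zero hp hm hpm hroots hvan
  constructor
  · intro htriv
    have hzero (j : Fin p) (g : Multiset ℂ) (hg : g ≤ f j) (hg0 : g.sum = 0) :
        (Pi.single j g : Fin p → Multiset ℂ) = 0 ∨ Pi.single j g = f := by
      have hz (i : Fin p) : ((Pi.single j g : Fin p → Multiset ℂ) i).sum = 0 := by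
        rcases eq_or_ne i j with rfl | hi
        · simpa using hg0
        · simp [hi]
      refine htriv _ (fun i => ?_) fun i k => (hz i).trans (hz k).symm
      rcases eq_or_ne i j with rfl | hi
      · simpa using hg
      · simp [hi]
    refine ⟨fun h0 => ?_, fun j g hg hg0 hgf hgs => ?_, ?_⟩
    · rcases hzero _ _ le_rfl h0 with h | h
      · exact hne _ (by simpa using h)
      · refine hne ⟨1, hp.one_lt⟩ ?_
        rw [← h]
        exact Pi.single_eq_of_ne (by simp) _
    · rcases hzero j g hg hgs with h | h
      · exact hg0 (by simpa using h)
      · exact hgf (by rw [← h, Pi.single_eq_same])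
    · rintro ⟨z, hz⟩
      choose g hg hg0 hgf hgz using hz
      rcases htriv g hg fun i j => (hgz i).trans (hgz j).symm with h | h
      · exact hg0 ⟨0, hp.pos⟩ (congrFun h _)
      · exact hgf ⟨0, hp.pos⟩ (congrFun h _)
  · rintro ⟨hi, hii, hiii⟩ g hgf hg
    by_cases hempty : ∃ i, g i = 0
    · obtain ⟨i, hi0⟩ := hempty
      left
      funext j
      by_contra hj
      have hj0 : (g j).sum = 0 := by rw [hg j i, hi0, Multiset.sum_zero]
      by_cases hjf : g j = f j
      · exact hi (by rw [hsum _ j, ← hjf, hj0])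
      · exact hii j _ (hgf j) hj hjf hj0
    · push Not at hempty
      right
      by_cases hfull : ∃ i, g i = f i
      · obtain ⟨i, hif⟩ := hfull
        funext j
        by_contra hj
        have hadd : f j - g j + g j = f j := Multiset.sub_add_cancel (hgf j)
        refine hii j (f j - g j) (Multiset.sub_le_self _ _) ?_ ?_ ?_
        · intro h0
          exact hj (by rw [← hadd, h0, zero_add])
        · intro h0
          rw [h0] at hadd
          exact hempty j (by simpa using hadd)
        · have := congrArg Multiset.sum hadd
          rw [Multiset.sum_add, hg j i, hif, hsum i j] at this
          simpa using this
      · push Not at hfull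
        exact absurd ⟨(g ⟨0, hp.pos⟩).sum, fun j =>
          ⟨g j, hgf j, hempty j, hfull j, hg j _⟩⟩ hiii
end

section
/- Every minimal vanishing sorou of weight at most 16 has height 1; that is, no root of unity occurs more than once as an element of such a sorou. -/
open Complex

open IntermediateField Polynomial in
theorem sum_pow_mul_eq_zero_imp {K : IntermediateField ℚ ℂ} {η : ℂ} (hη : IsIntegral K η) {d : ℕ}
    (hd : d ≤ (minpoly K η).natDegree) (w : ℕ → ℂ) (hw : ∀ i, w i ∈ K)
    (hsum : ∑ i ∈ Finset.range d, η ^ i * w i = 0) : ∀ i < d, w i = 0 := by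
  let q : K[X] := ∑ i ∈ Finset.range d, C ⟨w i, hw i⟩ * X ^ i
  have hq : aeval η q = 0 := by
    rw [← hsum, map_sum]
    refine Finset.sum_congr rfl fun i _ => ?_
    rw [map_mul, aeval_C, map_pow, aeval_X, mul_comm]; rfl
  have hq0 : q = 0 := by
    by_contra hne
    have h1 := minpoly.degree_le_of_ne_zero K η hne hq
    have h2 : q.degree < d := by
      rw [degree_lt_iff_coeff_zero]
      intro k hk
      simp [q, coeff_X_pow, not_lt.2 hk]
    rw [degree_eq_natDegree (minpoly.ne_zero hη)] at h1
    have h3 : ((minpoly K η).natDegree : WithBot ℕ) < d := h1.trans_lt h2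
    exact absurd hd (not_le.2 (by exact_mod_cast h3))
  intro i hi
  have hc : q.coeff i = ⟨w i, hw i⟩ := by
    simp [q, coeff_X_pow, hi]
  rw [hq0, coeff_zero] at hc
  exact (congrArg Subtype.val hc).symm

theorem exists_coset {m p : ℕ} (hm : 0 < m) (hp : 0 < p) {η : ℂ} (hη : IsPrimitiveRoot (η ^ m) p)
    {z : ℂ} (hz : z ^ (p * m) = 1) : ∃ i < p, ∃ y : ℂ, y ^ m = 1 ∧ z = η ^ i * y := by
  have : NeZero p := ⟨hp.ne'⟩
  obtain ⟨i, hi, h⟩ := hη.eq_pow_of_pow_eq_one (ξ := z ^ m) (by rw [← pow_mul, mul_comm, hz])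
  have hη0 : η ≠ 0 := by
    rintro rfl
    exact hη.ne_zero hp.ne' (zero_pow hm.ne')
  refine ⟨i, hi, z / η ^ i, ?_, by field_simp⟩
  rw [div_pow, ← h, pow_right_comm, div_self (pow_ne_zero _ (pow_ne_zero _ hη0))]

open IntermediateField Polynomial in
theorem totient_mul_le {m p : ℕ} (hm : 0 < m) (hp : 0 < p) {η : ℂ}
    (hη : IsPrimitiveRoot (η ^ m) p) {ζ : ℂ} (hζ : IsPrimitiveRoot ζ m) :
    IsIntegral ℚ⟮ζ⟯ η ∧ (p * m).totient ≤ m.totient * (minpoly ℚ⟮ζ⟯ η).natDegree := by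
  have hint : IsIntegral ℚ⟮ζ⟯ η := by
    refine IsIntegral.of_pow (n := m * p) (by positivity) ?_
    rw [pow_mul, hη.pow_eq_one]; exact isIntegral_one
  refine ⟨hint, ?_⟩
  have hζi : IsIntegral ℚ ζ := IsIntegral.of_pow hm (by rw [hζ.pow_eq_one]; exact isIntegral_one)
  have : FiniteDimensional ℚ ℚ⟮ζ⟯ := adjoin.finiteDimensional hζi
  have : FiniteDimensional ℚ⟮ζ⟯ ℚ⟮ζ⟯⟮η⟯ := adjoin.finiteDimensional hint
  have : FiniteDimensional ℚ ℚ⟮ζ⟯⟮η⟯ := FiniteDimensional.trans ℚ ℚ⟮ζ⟯ ℚ⟮ζ⟯⟮η⟯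
  have hmul : Module.finrank ℚ ℚ⟮ζ⟯ * Module.finrank ℚ⟮ζ⟯ ℚ⟮ζ⟯⟮η⟯ = Module.finrank ℚ ℚ⟮ζ⟯⟮η⟯ :=
    Module.finrank_mul_finrank _ _ _
  rw [adjoin.finrank hζi, adjoin.finrank hint, ← cyclotomic_eq_minpoly_rat hζ hm,
    natDegree_cyclotomic] at hmul
  rw [hmul]
  have hn : 0 < p * m := by positivity
  have hξ : IsPrimitiveRoot (Complex.exp (2 * Real.pi * Complex.I / (p * m : ℕ))) (p * m) :=
    Complex.isPrimitiveRoot_exp _ hn.ne'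
  set ξ := Complex.exp (2 * Real.pi * Complex.I / (p * m : ℕ))
  have hmem : ξ ∈ ℚ⟮ζ⟯⟮η⟯ := by
    obtain ⟨i, -, y, hy, h⟩ := exists_coset hm hp hη hξ.pow_eq_one
    have : NeZero m := ⟨hm.ne'⟩
    obtain ⟨k, -, rfl⟩ := hζ.eq_pow_of_pow_eq_one hy
    rw [h]
    refine mul_mem (pow_mem (mem_adjoin_simple_self _ _) _) (pow_mem ?_ _)
    exact (ℚ⟮ζ⟯⟮η⟯).algebraMap_mem ⟨ζ, mem_adjoin_simple_self _ _⟩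
  have h1 := minpoly.natDegree_le (A := ℚ) (⟨ξ, hmem⟩ : ℚ⟮ζ⟯⟮η⟯)
  have h2 : minpoly ℚ (⟨ξ, hmem⟩ : ℚ⟮ζ⟯⟮η⟯) = minpoly ℚ ξ :=
    (minpoly.algebraMap_eq (A := ℚ) (algebraMap ℚ⟮ζ⟯⟮η⟯ ℂ).injective ⟨ξ, hmem⟩).symm
  rwa [h2, ← cyclotomic_eq_minpoly_rat hξ hn, natDegree_cyclotomic] at h1

theorem isMinVanishing_map_mul {c : ℂ} (hc : c ≠ 0) {h : Multiset ℂ} (hmv : IsMinVanishing h) :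
    IsMinVanishing (h.map (c * ·)) := by
  have key : ∀ g : Multiset ℂ, (g.map (c * ·)).sum = c * g.sum := fun g => by
    rw [Multiset.sum_map_mul_left, Multiset.map_id']
  refine ⟨by rw [key, hmv.1, mul_zero], fun g hg h0 hne => ?_⟩
  have hinv : (g.map (c⁻¹ * ·)).map (c * ·) = g := by
    simp [Multiset.map_map, mul_inv_cancel_left₀ hc]
  have hinv' : (h.map (c * ·)).map (c⁻¹ * ·) = h := by
    simp [Multiset.map_map, inv_mul_cancel_left₀ hc]
  have hle : g.map (c⁻¹ * ·) ≤ h := hinv' ▸ Multiset.map_le_map hg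
  rw [← hinv, key]
  refine mul_ne_zero hc (hmv.2 _ hle ?_ ?_)
  · simpa using h0
  · rintro rfl
    exact hne hinv.symm

/-- A decomposition of `h` into `p` pieces along the cosets `η ^ i * μ_m`, all of the same
nonzero value `v` after rotating back. -/
structure IsCellDecomp (h : Multiset ℂ) (m p : ℕ) (η : ℂ) (f : ℕ → Multiset ℂ) (v : ℂ) : Prop where
  primitive : IsPrimitiveRoot (η ^ m) p
  sum_pow : ∑ i ∈ Finset.range p, η ^ i = 0
  pow_eq_one : ∀ i, ∀ y ∈ f i, y ^ m = 1
  eq_sum : h = ∑ i ∈ Finset.range p, (f i).map (η ^ i * ·)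
  sum_eq : ∀ i < p, (f i).sum = v
  value_ne_zero : v ≠ 0

theorem exists_cells {m p : ℕ} (hm : 0 < m) (hp : 0 < p) {η : ℂ} (hη : IsPrimitiveRoot (η ^ m) p)
    (h : Multiset ℂ) (hh : ∀ z ∈ h, z ^ (p * m) = 1) :
    ∃ f : ℕ → Multiset ℂ, (∀ i, ∀ y ∈ f i, y ^ m = 1) ∧
      h = ∑ i ∈ Finset.range p, (f i).map (η ^ i * ·) := by
  induction h using Multiset.induction_on with
  | empty => exact ⟨fun _ => 0, by simp, by simp⟩
  | cons z s ih =>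
    obtain ⟨f, hf, hs⟩ := ih fun z hz => hh z (Multiset.mem_cons_of_mem hz)
    obtain ⟨i, hi, y, hy, rfl⟩ := exists_coset hm hp hη (hh z (Multiset.mem_cons_self _ _))
    refine ⟨fun j => (if j = i then {y} else 0) + f j, ?_, ?_⟩
    · intro j x hx
      rcases Multiset.mem_add.1 hx with hx | hx
      · split_ifs at hx
        · rwa [Multiset.mem_singleton.1 hx]
        · simp at hx
      · exact hf j x hx
    · simp only [Multiset.map_add, Finset.sum_add_distrib, ← hs, apply_ite (Multiset.map _),
        Multiset.map_singleton, Multiset.map_zero]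
      have : ∑ j ∈ Finset.range p, (if j = i then ({η ^ j * y} : Multiset ℂ) else 0)
          = {η ^ i * y} := by
        rw [Finset.sum_ite_eq' (Finset.range p) i fun j => ({η ^ j * y} : Multiset ℂ)]
        simp [hi]
      rw [this, Multiset.singleton_add]

theorem sum_cells (p : ℕ) (η : ℂ) (f : ℕ → Multiset ℂ) :
    (∑ i ∈ Finset.range p, (f i).map (η ^ i * ·)).sum
      = ∑ i ∈ Finset.range p, η ^ i * (f i).sum := by
  rw [← Multiset.coe_sumAddMonoidHom, map_sum]
  refine Finset.sum_congr rfl fun i _ => ?_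
  rw [Multiset.coe_sumAddMonoidHom, Multiset.sum_map_mul_left, Multiset.map_id']

theorem exists_cell_sum_ne_zero {h : Multiset ℂ} (h0 : h ≠ 0) (hmv : IsMinVanishing h) {m p : ℕ}
    (hm : 0 < m) (hp : p.Prime)
    (hmin : ∀ c ≠ 0, ∀ k : ℕ, 0 < k → (∀ z ∈ h, (c * z) ^ k = 1) → p * m ≤ k)
    {η : ℂ} (hη : η ≠ 0) {f : ℕ → Multiset ℂ} (hf : ∀ i, ∀ y ∈ f i, y ^ m = 1)
    (hh : h = ∑ i ∈ Finset.range p, (f i).map (η ^ i * ·)) :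
    ∃ i < p, (f i).sum ≠ 0 := by
  by_contra! hv
  have : ∃ i < p, f i ≠ 0 := by
    by_contra! hz
    refine h0 (hh.trans (Finset.sum_eq_zero fun i hi => ?_))
    rw [hz i (Finset.mem_range.1 hi), Multiset.map_zero]
  obtain ⟨i, hi, hfi⟩ := this
  have hle : (f i).map (η ^ i * ·) ≤ h := by
    rw [hh]
    exact Finset.single_le_sum (f := fun i => (f i).map (η ^ i * ·))
      (fun _ _ => Multiset.zero_le _) (Finset.mem_range.2 hi)
  have heq : (f i).map (η ^ i * ·) = h := by
    by_contra hne
    refine hmv.2 _ hle (by simpa using hfi) hne ?_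
    rw [Multiset.sum_map_mul_left, Multiset.map_id', hv i hi, mul_zero]
  have := hmin (η ^ i)⁻¹ (inv_ne_zero (pow_ne_zero _ hη)) m hm (by
    intro z hz
    rw [← heq] at hz
    obtain ⟨y, hy, rfl⟩ := Multiset.mem_map.1 hz
    rw [inv_mul_cancel_left₀ (pow_ne_zero _ hη), hf i y hy])
  nlinarith [hp.two_le]

/-- If `μ_{pm}` is the smallest group of roots of unity containing a rotation of a minimal
vanishing sorou, then `p ∤ m` and the sorou splits into `p` cells of equal nonzero value. -/
theorem exists_isCellDecomp {h : Multiset ℂ} (h0 : h ≠ 0) (hmv : IsMinVanishing h) {m p : ℕ}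
    (hm : 0 < m) (hp : p.Prime) (hh : ∀ z ∈ h, z ^ (p * m) = 1)
    (hmin : ∀ c ≠ 0, ∀ k : ℕ, 0 < k → (∀ z ∈ h, (c * z) ^ k = 1) → p * m ≤ k) :
    ¬ p ∣ m ∧ ∃ η f v, IsCellDecomp h m p η f v := by
  have hζ := Complex.isPrimitiveRoot_exp m hm.ne'
  set ζ := Complex.exp (2 * Real.pi * Complex.I / m)
  have hK : ∀ f : ℕ → Multiset ℂ, (∀ i, ∀ y ∈ f i, y ^ m = 1) →
      ∀ i, (f i).sum ∈ IntermediateField.adjoin ℚ {ζ} := by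
    intro f hf i
    refine multiset_sum_mem _ fun y hy => ?_
    have : NeZero m := ⟨hm.ne'⟩
    obtain ⟨k, -, rfl⟩ := hζ.eq_pow_of_pow_eq_one (hf i y hy)
    exact pow_mem (IntermediateField.mem_adjoin_simple_self _ _) _
  by_cases hdvd : p ∣ m
  · exfalso
    have hξ := Complex.isPrimitiveRoot_exp (p * m) (mul_pos hp.pos hm).ne'
    set ξ := Complex.exp (2 * Real.pi * Complex.I / (p * m : ℕ))
    have hη : IsPrimitiveRoot (ξ ^ m) p := hξ.pow (mul_pos hp.pos hm) (mul_comm p m)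
    obtain ⟨f, hf, hhf⟩ := exists_cells hm hp.pos hη h hh
    obtain ⟨hint, hdeg⟩ := totient_mul_le hm hp.pos hη hζ
    rw [Nat.totient_mul_of_prime_of_dvd hp hdvd, mul_comm] at hdeg
    obtain ⟨i, hi, hne⟩ := exists_cell_sum_ne_zero h0 hmv hm hp hmin
      (hξ.ne_zero (mul_pos hp.pos hm).ne') hf hhf
    refine hne (sum_pow_mul_eq_zero_imp hint
      (Nat.le_of_mul_le_mul_left hdeg (Nat.totient_pos.2 hm)) _ (hK f hf) ?_ i hi)
    rw [← sum_cells, ← hhf, hmv.1]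
  · refine ⟨hdvd, ?_⟩
    have hη := Complex.isPrimitiveRoot_exp p hp.pos.ne'
    set η := Complex.exp (2 * Real.pi * Complex.I / p)
    have hηm : IsPrimitiveRoot (η ^ m) p :=
      hη.pow_of_coprime m ((Nat.Prime.coprime_iff_not_dvd hp).2 hdvd).symm
    obtain ⟨f, hf, hhf⟩ := exists_cells hm hp.pos hηm h hh
    obtain ⟨hint, hdeg⟩ := totient_mul_le hm hp.pos hηm hζ
    rw [Nat.totient_mul_of_prime_of_not_dvd hp hdvd, mul_comm] at hdeg
    have hsum0 : ∑ i ∈ Finset.range p, η ^ i = 0 := hη.geom_sum_eq_zero hp.one_lt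
    have hall : ∀ i < p - 1, (f i).sum - (f (p - 1)).sum = 0 := by
      refine sum_pow_mul_eq_zero_imp hint
        (Nat.le_of_mul_le_mul_left hdeg (Nat.totient_pos.2 hm))
        (fun i => (f i).sum - (f (p - 1)).sum)
        (fun i => sub_mem (hK f hf i) (hK f hf _)) ?_
      have h1 : ∑ i ∈ Finset.range p, η ^ i * ((f i).sum - (f (p - 1)).sum) = 0 := by
        simp only [mul_sub, Finset.sum_sub_distrib]
        rw [← Finset.sum_mul, hsum0, ← sum_cells, ← hhf, hmv.1]; simp
      obtain ⟨q, rfl⟩ : ∃ q, p = q + 1 := ⟨p - 1, by have := hp.pos; omega⟩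
      rw [Finset.sum_range_succ] at h1
      simpa using h1
    have hall' : ∀ i < p, (f i).sum = (f (p - 1)).sum := by
      intro i hi
      rcases Nat.lt_or_ge i (p - 1) with h1 | h1
      · exact sub_eq_zero.1 (hall i h1)
      · rw [show i = p - 1 by omega]
    obtain ⟨i, hi, hne⟩ := exists_cell_sum_ne_zero h0 hmv hm hp hmin
      (hη.ne_zero hp.pos.ne') hf hhf
    exact ⟨η, f, _, hηm, hsum0, hf, hhf, hall', hall' i hi ▸ hne⟩

/-- No nonempty sub-multiset of `A` has sum zero. -/
def ZeroSumFree (A : Multiset ℂ) : Prop := ∀ g ≤ A, g ≠ 0 → g.sum ≠ 0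

theorem le_cons_cases {x : ℂ} {g A : Multiset ℂ} (h : g ≤ x ::ₘ A) :
    g ≤ A ∨ ∃ g' ≤ A, g = x ::ₘ g' := by
  by_cases hx : x ∈ g
  · obtain ⟨g', rfl⟩ := Multiset.exists_cons_of_mem hx
    exact Or.inr ⟨g', (Multiset.cons_le_cons_iff _).1 h, rfl⟩
  · exact Or.inl ((Multiset.le_cons_of_notMem hx).1 h)

theorem sum_tsub {g A : Multiset ℂ} (h : g ≤ A) : (A - g).sum = A.sum - g.sum := by
  rw [eq_sub_iff_add_eq, ← Multiset.sum_add, tsub_add_cancel_of_le h]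

theorem ZeroSumFree.eq_of_sum_eq {A g : Multiset ℂ} (hA : ZeroSumFree A) (hg : g ≤ A)
    (h : g.sum = A.sum) : g = A := by
  by_contra hne
  refine hA (A - g) tsub_le_self ?_ (by rw [sum_tsub hg, h, sub_self])
  rw [Ne, tsub_eq_zero_iff_le]
  exact fun h' => hne (le_antisymm hg h')

theorem ZeroSumFree.isMinVanishing_cons {A : Multiset ℂ} (hA : ZeroSumFree A) {u : ℂ}
    (hu : A.sum = u) : IsMinVanishing (-u ::ₘ A) := by
  refine ⟨by simp [hu], fun g hg h0 hne hsum => ?_⟩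
  rcases le_cons_cases hg with hg | ⟨g, hg', rfl⟩
  · exact hA g hg h0 hsum
  · refine hne (congrArg _ (hA.eq_of_sum_eq hg' ?_))
    rw [Multiset.sum_cons] at hsum
    linear_combination hsum - hu

theorem ZeroSumFree.isMinVanishing_cons_cons {A : Multiset ℂ} (hA : ZeroSumFree A) {a b : ℂ}
    (hab : A.sum = a + b) (ha : ∀ g ≤ A, g.sum ≠ a) : IsMinVanishing (-a ::ₘ -b ::ₘ A) := by
  refine ⟨by simp [hab], fun g hg h0 hne hsum => ?_⟩
  rcases le_cons_cases hg with h₁ | ⟨g₁, h₁, rfl⟩ <;>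
  rcases le_cons_cases h₁ with h₂ | ⟨g₂, h₂, rfl⟩ <;>
  try simp only [Multiset.sum_cons] at hsum
  · exact hA g h₂ h0 hsum
  · refine ha (A - g₂) tsub_le_self ?_
    rw [sum_tsub h₂, hab]
    linear_combination -hsum
  · exact ha g₁ h₂ (by linear_combination hsum)
  · refine hne (congrArg _ (congrArg _ (hA.eq_of_sum_eq h₂ ?_)))
    linear_combination hsum - hab

section Cells

variable {h : Multiset ℂ} {m p : ℕ} {η : ℂ} {f : ℕ → Multiset ℂ} {v : ℂ}

theorem IsCellDecomp.card_eq (hd : IsCellDecomp h m p η f v) :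
    Multiset.card h = ∑ i ∈ Finset.range p, Multiset.card (f i) := by
  rw [hd.eq_sum, Multiset.card_sum]
  simp

theorem IsCellDecomp.eq_of_le (hd : IsCellDecomp h m p η f v) (hmv : IsMinVanishing h)
    {g : ℕ → Multiset ℂ} (hg : ∀ i < p, g i ≤ f i)
    (hsum : ∑ i ∈ Finset.range p, η ^ i * (g i).sum = 0) (hne : ∃ i < p, g i ≠ 0) :
    ∀ i < p, g i = f i := by
  have hle : ∑ i ∈ Finset.range p, (g i).map (η ^ i * ·) ≤ h := by
    rw [hd.eq_sum]
    exact Finset.sum_le_sum fun i hi => Multiset.map_le_map (hg i (Finset.mem_range.1 hi))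
  have heq : ∑ i ∈ Finset.range p, (g i).map (η ^ i * ·) = h := by
    by_contra hne'
    refine hmv.2 _ hle ?_ hne' (by rw [sum_cells, hsum])
    intro h0
    obtain ⟨i, hi, hi'⟩ := hne
    rw [Finset.sum_eq_zero_iff] at h0
    exact hi' (by simpa using h0 i (Finset.mem_range.2 hi))
  have hcard := hd.card_eq
  rw [← heq, Multiset.card_sum] at hcard
  simp only [Multiset.card_map] at hcard
  rw [Finset.sum_eq_sum_iff_of_le fun i hi =>
    Multiset.card_le_card (hg i (Finset.mem_range.1 hi))] at hcard
  exact fun i hi => Multiset.eq_of_le_of_card_le (hg i hi) (hcard i (Finset.mem_range.2 hi)).ge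

theorem IsCellDecomp.cell_ne_zero (hd : IsCellDecomp h m p η f v) {i : ℕ} (hi : i < p) :
    f i ≠ 0 := by
  intro h0
  have := hd.sum_eq i hi
  rw [h0, Multiset.sum_zero] at this
  exact hd.value_ne_zero this.symm

theorem IsCellDecomp.zeroSumFree (hd : IsCellDecomp h m p η f v) (hmv : IsMinVanishing h)
    {i : ℕ} (hi : i < p) : ZeroSumFree (f i) := by
  intro g hg h0 hsum
  have := hd.eq_of_le hmv (g := fun j => if j = i then g else 0) ?_ ?_ ⟨i, hi, by simpa using h0⟩
  · have h1 := hd.sum_eq i hi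
    rw [← this i hi, if_pos rfl, hsum] at h1
    exact hd.value_ne_zero h1.symm
  · intro j _
    split_ifs with hj
    · rwa [hj]
    · exact Multiset.zero_le _
  · refine Finset.sum_eq_zero fun j _ => ?_
    split_ifs <;> simp [hsum]

theorem IsCellDecomp.value_eq_of_forall_exists (hd : IsCellDecomp h m p η f v)
    (hmv : IsMinVanishing h) (hp : 0 < p) {u : ℂ} (hu : u ≠ 0)
    (hs : ∀ i < p, ∃ g ≤ f i, g.sum = u) : v = u := by
  choose! g hg hgu using hs
  have := hd.eq_of_le hmv (g := g) hg ?_ ⟨0, hp, ?_⟩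
  · rw [← hd.sum_eq 0 hp, ← hgu 0 hp, this 0 hp]
  · rw [Finset.sum_congr rfl fun i hi => by rw [hgu i (Finset.mem_range.1 hi)],
      ← Finset.sum_mul, hd.sum_pow, zero_mul]
  · intro h0
    have := hgu 0 hp
    rw [h0, Multiset.sum_zero] at this
    exact hu this.symm

theorem IsCellDecomp.nodup (hd : IsCellDecomp h m p η f v) (hη : η ≠ 0)
    (hf : ∀ i < p, (f i).Nodup) : h.Nodup := by
  have hb : h = (Finset.range p).val.bind fun i => (f i).map (η ^ i * ·) := hd.eq_sum
  rw [hb, Multiset.nodup_bind]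
  refine ⟨fun i hi => (hf i (Finset.mem_range.1 hi)).map
    (mul_right_injective₀ (pow_ne_zero _ hη)), ?_⟩
  refine (Finset.range p).nodup.pairwise fun i hi j hj hij => ?_
  refine Multiset.disjoint_left.2 fun hx hx' => ?_
  obtain ⟨y, hy, rfl⟩ := Multiset.mem_map.1 hx
  obtain ⟨y', hy', heq⟩ := Multiset.mem_map.1 hx'
  refine hij (hd.primitive.pow_inj (Finset.mem_range.1 hi) (Finset.mem_range.1 hj) ?_)
  have := congrArg (· ^ m) heq
  simpa [mul_pow, hd.pow_eq_one i y hy, hd.pow_eq_one j y' hy', pow_right_comm _ m] using this.symm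

theorem IsCellDecomp.ne_zero (hd : IsCellDecomp h m p η f v) (hm : 0 < m) (hp : 0 < p) :
    η ≠ 0 := by
  rintro rfl
  exact hd.primitive.ne_zero hp.ne' (zero_pow hm.ne')

theorem isRootOfUnity_neg {z : ℂ} (hz : IsRootOfUnity z) : IsRootOfUnity (-z) := by
  obtain ⟨n, hn, hz⟩ := hz
  exact ⟨2 * n, by omega, by rw [pow_mul, neg_sq, pow_right_comm, hz, one_pow]⟩

/-- If the common value of the cells is a root of unity, heights are controlled by shorter
minimal vanishing sorous. -/
theorem IsCellDecomp.nodup_of_isRootOfUnity (hd : IsCellDecomp h m p η f v)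
    (hmv : IsMinVanishing h) (hm : 0 < m) (hp : 3 ≤ p) (hv : IsRootOfUnity v)
    (ih : ∀ h', IsSorou h' → IsMinVanishing h' → Multiset.card h' < Multiset.card h → h'.Nodup) :
    h.Nodup := by
  refine hd.nodup (hd.ne_zero hm (by omega)) fun i hi => ?_
  suffices (-v ::ₘ f i).Nodup from (Multiset.nodup_cons.1 this).2
  refine ih _ ⟨Multiset.cons_ne_zero, ?_⟩
    ((hd.zeroSumFree hmv hi).isMinVanishing_cons (hd.sum_eq i hi)) ?_
  · intro z hz
    rcases Multiset.mem_cons.1 hz with rfl | hz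
    · exact isRootOfUnity_neg hv
    · exact ⟨m, hm, hd.pow_eq_one i z hz⟩
  · rw [Multiset.card_cons, hd.card_eq, ← Finset.add_sum_erase _ _ (Finset.mem_range.2 hi)]
    have : ∑ j ∈ (Finset.range p).erase i, 1
        ≤ ∑ j ∈ (Finset.range p).erase i, Multiset.card (f j) := by
      refine Finset.sum_le_sum fun j hj => ?_
      rw [Nat.one_le_iff_ne_zero, Ne, Multiset.card_eq_zero]
      exact hd.cell_ne_zero (Finset.mem_range.1 (Finset.mem_of_mem_erase hj))
    rw [Finset.sum_const, Finset.card_erase_of_mem (Finset.mem_range.2 hi), Finset.card_range,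
      smul_eq_mul] at this
    omega

end Cells

theorem re_mul_sum_pos {c : ℂ} {f : Multiset ℂ} (h0 : f ≠ 0) (hf : ∀ z ∈ f, 0 < (c * z).re) :
    0 < (c * f.sum).re := by
  induction f using Multiset.induction_on with
  | empty => exact absurd rfl h0
  | cons z s ih =>
    rw [Multiset.sum_cons, mul_add, add_re]
    have hz := hf z (Multiset.mem_cons_self _ _)
    by_cases hs : s = 0
    · simpa [hs] using hz
    · exact add_pos hz (ih hs fun y hy => hf y (Multiset.mem_cons_of_mem hy))

theorem pair_le {x y : ℂ} {f : Multiset ℂ} (hxy : x ≠ y) (hx : x ∈ f) (hy : y ∈ f) :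
    {x, y} ≤ f := by
  rw [Multiset.le_iff_subset (by simpa using hxy)]
  intro z hz
  simp only [Multiset.insert_eq_cons, Multiset.mem_cons, Multiset.mem_singleton] at hz
  rcases hz with rfl | rfl <;> assumption

theorem false_of_max_re_of_notMem {r r' : ℂ} (hadd : r + r' = 1) (hmul : r * r' = 1)
    (hr : r.re = 1 / 2) (hr' : r'.re = 1 / 2) {f : Multiset ℂ} (hf : ∀ z ∈ f, z ^ 6 = 1)
    (hzf : ZeroSumFree f) (h0 : f ≠ 0) (hmax : ∀ k : ℂ, k ^ 6 = 1 → (f.sum * k).re ≤ f.sum.re)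
    (h1 : 1 ∉ f) (hr'f : r' ∉ f) : False := by
  have hmem : ∀ z ∈ f, z = -1 ∨ z = r ∨ z = -r ∨ z = -r' := by
    intro z hz
    have : (z - 1) * (z + 1) * (z - r) * (z - r') * (z + r) * (z + r') = 0 := by
      have e1 : (z - r) * (z - r') = z ^ 2 - z + 1 := by linear_combination hmul - z * hadd
      have e2 : (z + r) * (z + r') = z ^ 2 + z + 1 := by linear_combination hmul + z * hadd
      calc _ = (z - 1) * (z + 1) * ((z - r) * (z - r')) * ((z + r) * (z + r')) := by ring
        _ = z ^ 6 - 1 := by rw [e1, e2]; ring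
        _ = 0 := by rw [hf z hz, sub_self]
    simp only [mul_eq_zero, sub_eq_zero, add_eq_zero_iff_eq_neg] at this
    rcases this with ((((h | h) | h) | h) | h) | h
    · exact absurd (h ▸ hz) h1
    · exact .inl h
    · exact .inr (.inl h)
    · exact absurd (h ▸ hz) hr'f
    · exact .inr (.inr (.inl h))
    · exact .inr (.inr (.inr h))
  by_cases hrf : r ∈ f
  · have hnr : -r ∉ f := by
      intro h
      refine hzf {r, -r} (pair_le ?_ hrf h) (by simp) (by simp)
      intro h
      have := congrArg re h
      rw [neg_re, hr] at this
      norm_num at this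
    have hr6 : r' ^ 6 = 1 := by
      have e : r' ^ 2 = r' - 1 := by linear_combination r' * hadd - hmul
      calc r' ^ 6 = (r' ^ 2) ^ 3 := by ring
        _ = 1 := by rw [e]; linear_combination (r' - 2) * e
    have hpos := re_mul_sum_pos (c := r' - 1) h0 fun z hz => by
      rcases hmem z hz with rfl | rfl | rfl | rfl
      · simp [hr']; norm_num
      · rw [show (r' - 1) * z = 1 - z by linear_combination hmul]
        simp [hr]; norm_num
      · exact absurd hz hnr
      · rw [show (r' - 1) * -r' = 1 by linear_combination hmul - r' * hadd]
        simp
    have := hmax r' hr6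
    rw [sub_mul, sub_re, one_mul, mul_comm r'] at hpos
    linarith
  · have hpos := re_mul_sum_pos (c := -1) h0 fun z hz => by
      rcases hmem z hz with rfl | rfl | rfl | rfl
      · simp
      · exact absurd hz hrf
      · simp [hr]
      · simp [hr']
    have := hmax (-1) (by norm_num)
    simp at hpos this
    linarith

theorem exists_sum_eq_one {f : Multiset ℂ} (hf : ∀ z ∈ f, z ^ 6 = 1) (hzf : ZeroSumFree f)
    (h0 : f ≠ 0) (hmax : ∀ k : ℂ, k ^ 6 = 1 → (f.sum * k).re ≤ f.sum.re) :
    ∃ g ≤ f, g.sum = 1 := by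
  have hs : (√3 : ℝ) * √3 = 3 := Real.mul_self_sqrt (by norm_num)
  let r : ℂ := ⟨1 / 2, √3 / 2⟩
  let r' : ℂ := ⟨1 / 2, -(√3 / 2)⟩
  have hadd : r + r' = 1 := by apply Complex.ext <;> norm_num [r, r']
  have hmul : r * r' = 1 := by
    apply Complex.ext
    · simp only [r, r', mul_re, one_re]; linarith
    · simp only [r, r', mul_im, one_im]; ring
  by_cases h1 : 1 ∈ f
  · exact ⟨{1}, Multiset.singleton_le.2 h1, by simp⟩
  by_cases hr' : r' ∈ f
  · by_cases hr : r ∈ f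
    · refine ⟨{r, r'}, pair_le ?_ hr hr', by simp [hadd]⟩
      intro h
      have := congrArg im h
      simp only [r, r'] at this
      nlinarith
    · exact (false_of_max_re_of_notMem (add_comm r r' ▸ hadd) (mul_comm r r' ▸ hmul) rfl rfl
        hf hzf h0 hmax h1 hr).elim
  · exact (false_of_max_re_of_notMem hadd hmul rfl rfl hf hzf h0 hmax h1 hr').elim

theorem exists_common_subsum {v : ℂ} (hv : v ≠ 0) :
    ∃ u : ℂ, u ^ 6 = 1 ∧ ∀ f : Multiset ℂ, (∀ z ∈ f, z ^ 6 = 1) → ZeroSumFree f → f.sum = v →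
      ∃ g ≤ f, g.sum = u := by
  have hmem : ∀ k : ℂ, k ∈ Polynomial.nthRootsFinset 6 (1 : ℂ) ↔ k ^ 6 = 1 :=
    fun k => Polynomial.mem_nthRootsFinset (by norm_num) 1
  obtain ⟨k, hk, hmax⟩ := (Polynomial.nthRootsFinset 6 (1 : ℂ)).exists_max_image
    (fun k => (k * v).re) ⟨1, (hmem 1).2 (one_pow 6)⟩
  rw [hmem] at hk
  have hk0 : k ≠ 0 := by rintro rfl; norm_num at hk
  have hinv : ∀ g : Multiset ℂ, (g.map (k * ·)).map (k⁻¹ * ·) = g := fun g => by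
    simp [Multiset.map_map, inv_mul_cancel_left₀ hk0]
  have hsum : ∀ (c : ℂ) (g : Multiset ℂ), (g.map (c * ·)).sum = c * g.sum := fun c g => by
    rw [Multiset.sum_map_mul_left, Multiset.map_id']
  refine ⟨k⁻¹, by rw [inv_pow, hk, inv_one], fun f hf hzf hfv => ?_⟩
  suffices ∃ g ≤ f.map (k * ·), g.sum = 1 by
    obtain ⟨g, hg, hg1⟩ := this
    refine ⟨g.map (k⁻¹ * ·), hinv f ▸ Multiset.map_le_map hg, ?_⟩
    rw [hsum, hg1, mul_one]
  refine exists_sum_eq_one ?_ ?_ ?_ ?_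
  · intro z hz
    obtain ⟨y, hy, rfl⟩ := Multiset.mem_map.1 hz
    rw [mul_pow, hk, hf y hy, one_mul]
  · intro g hg h0 hg0
    refine hzf (g.map (k⁻¹ * ·)) (hinv f ▸ Multiset.map_le_map hg) (by simpa using h0) ?_
    rw [hsum, hg0, mul_zero]
  · rintro h0
    rw [Multiset.map_eq_zero] at h0
    exact hv (by rw [← hfv, h0, Multiset.sum_zero])
  · intro k' hk'
    rw [hsum, hfv]
    have := hmax (k * k') ((hmem _).2 (by rw [mul_pow, hk, hk', one_mul]))
    rwa [mul_right_comm] at this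

theorem IsRootOfUnity.norm_eq_one {z : ℂ} (hz : IsRootOfUnity z) : ‖z‖ = 1 := by
  obtain ⟨n, hn, hz⟩ := hz
  exact Complex.norm_eq_one_of_pow_eq_one hz hn.ne'

theorem eq_or_eq_of_add_eq_add {a b c d : ℂ} (ha : ‖a‖ = 1) (hb : ‖b‖ = 1) (hc : ‖c‖ = 1)
    (hd : ‖d‖ = 1) (h : c + d = a + b) (h0 : a + b ≠ 0) : c = a ∨ c = b := by
  have hne : ∀ {z : ℂ}, ‖z‖ = 1 → z ≠ 0 := fun hz h => by simp [h] at hz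
  have ha0 := hne ha
  have hb0 := hne hb
  have hc0 := hne hc
  have hd0 := hne hd
  have hconj : c⁻¹ + d⁻¹ = a⁻¹ + b⁻¹ := by
    rw [inv_eq_conj ha, inv_eq_conj hb, inv_eq_conj hc, inv_eq_conj hd, ← map_add, ← map_add, h]
  field_simp at hconj
  have hprod : a * b = c * d := by
    refine mul_left_cancel₀ h0 ?_
    linear_combination hconj - a * b * h
  have : (c - a) * (c - b) = 0 := by linear_combination hprod + c * h
  simpa [sub_eq_zero] using this

theorem two_mul_ne_of_norm {x c : ℂ} (hx : ‖x‖ = 1) (hc : ‖c‖ = 1) : c + c ≠ x := by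
  rintro rfl
  rw [← two_mul, norm_mul, hc] at hx
  norm_num at hx

theorem false_of_repeated_cell {a b c d : ℂ} {A : Multiset ℂ} (hb : ‖b‖ = 1)
    (hc : ‖c‖ = 1) (hd : ‖d‖ = 1) (hA : ∀ z ∈ A, ‖z‖ = 1) (hzf : ZeroSumFree A)
    (hcard : Multiset.card A = 3) (hsum : A.sum = a + b) (hcd : c + c + d = a + b)
    (hsplit : ∀ g ≤ A, g.sum ≠ a) (hacd : a = c ∨ a = d)
    (hmin : ¬ IsMinVanishing (-c ::ₘ -c ::ₘ -d ::ₘ A)) : False := by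
  rcases hacd with rfl | rfl
  swap
  · exact two_mul_ne_of_norm hb hc (by linear_combination hcd)
  have hne : ∀ {z : ℂ}, ‖z‖ = 1 → z ≠ 0 := fun hz h => by simp [h] at hz
  have hdouble : ∀ g ≤ A, g.sum ≠ a + a := by
    intro g hg hga
    have hle := Multiset.card_le_card hg
    rw [hcard] at hle
    have hgn : ∀ z ∈ g, ‖z‖ = 1 := fun z hz => hA z (Multiset.mem_of_le hg hz)
    have haa : a + a ≠ 0 := by rw [← two_mul]; exact mul_ne_zero two_ne_zero (hne hc)
    interval_cases hk : Multiset.card g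
    · rw [Multiset.card_eq_zero] at hk
      rw [hk, Multiset.sum_zero] at hga
      exact haa hga.symm
    · obtain ⟨x, rfl⟩ := Multiset.card_eq_one.1 hk
      rw [Multiset.sum_singleton] at hga
      exact two_mul_ne_of_norm (hgn x (by simp)) hc hga.symm
    · obtain ⟨x, y, rfl⟩ := Multiset.card_eq_two.1 hk
      have hxy : x + y = a + a := by simpa using hga
      have hx : x = a := by
        simpa using eq_or_eq_of_add_eq_add hc hc (hgn x (by simp)) (hgn y (by simp)) hxy haa
      exact hsplit {a} (Multiset.singleton_le.2 (Multiset.mem_of_le hg (by simp [hx]))) (by simp)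
    · rw [Multiset.eq_of_le_of_card_le hg (by rw [hk, hcard])] at hga
      exact hne hd (by linear_combination hcd + hga - hsum)
  have hdiff : ∀ g ≤ A, g.sum ≠ a + d := fun g hg h =>
    hsplit (A - g) tsub_le_self (by rw [sum_tsub hg]; linear_combination hsum - h - hcd)
  have hdiff' : ∀ g ≤ A, g.sum ≠ d := fun g hg h =>
    hdouble (A - g) tsub_le_self (by rw [sum_tsub hg]; linear_combination hsum - h - hcd)
  refine hmin ⟨?_, fun g hg h0 hne' hg0 => ?_⟩
  · simp only [Multiset.sum_cons]; linear_combination hsum - hcd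
  rcases le_cons_cases hg with h₁ | ⟨g₁, h₁, rfl⟩ <;>
  rcases le_cons_cases h₁ with h₂ | ⟨g₂, h₂, rfl⟩ <;>
  rcases le_cons_cases h₂ with h₃ | ⟨g₃, h₃, rfl⟩ <;>
  try simp only [Multiset.sum_cons] at hg0
  · exact hzf g h₃ h0 hg0
  · exact hdiff' _ h₃ (by linear_combination hg0)
  · exact hsplit _ h₃ (by linear_combination hg0)
  · exact hdiff _ h₃ (by linear_combination hg0)
  · exact hsplit _ h₃ (by linear_combination hg0)
  · exact hdiff _ h₃ (by linear_combination hg0)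
  · exact hdouble _ h₃ (by linear_combination hg0)
  · rw [hzf.eq_of_sum_eq h₃ (by linear_combination hg0 + hcd - hsum)] at hne'
    exact hne' rfl

theorem two_mul_add_le_sum {p i : ℕ} (x : ℕ → ℕ) (hx : ∀ j < p, 2 ≤ x j) (hi : i < p) :
    2 * (p - 1) + x i ≤ ∑ j ∈ Finset.range p, x j := by
  rw [← Finset.add_sum_erase _ _ (Finset.mem_range.2 hi), add_comm]
  have : ((Finset.range p).erase i).card • 2 ≤ ∑ j ∈ (Finset.range p).erase i, x j :=
    Finset.card_nsmul_le_sum _ _ _ fun j hj =>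
      hx j (Finset.mem_range.1 (Finset.mem_of_mem_erase hj))
  rw [Finset.card_erase_of_mem (Finset.mem_range.2 hi), Finset.card_range, smul_eq_mul] at this
  omega

theorem two_mul_add_add_le_sum {p i j : ℕ} (x : ℕ → ℕ) (hx : ∀ j < p, 2 ≤ x j) (hi : i < p)
    (hj : j < p) (hij : i ≠ j) :
    2 * (p - 2) + x i + x j ≤ ∑ k ∈ Finset.range p, x k := by
  have hj' : j ∈ (Finset.range p).erase i := by simp [hj, hij.symm]
  rw [← Finset.add_sum_erase _ _ (Finset.mem_range.2 hi), ← Finset.add_sum_erase _ _ hj']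
  have : (((Finset.range p).erase i).erase j).card • 2
      ≤ ∑ k ∈ ((Finset.range p).erase i).erase j, x k :=
    Finset.card_nsmul_le_sum _ _ _ fun k hk =>
      hx k (Finset.mem_range.1 (Finset.mem_of_mem_erase (Finset.mem_of_mem_erase hk)))
  rw [Finset.card_erase_of_mem hj', Finset.card_erase_of_mem (Finset.mem_range.2 hi),
    Finset.card_range, smul_eq_mul] at this
  omega

theorem exists_eq_of_not_nodup {A : Multiset ℂ} (hA : ¬ A.Nodup) (hcard : Multiset.card A = 3) :
    ∃ c d, A = {c, c, d} := by
  rw [Multiset.nodup_iff_le] at hA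
  push Not at hA
  obtain ⟨c, hc⟩ := hA
  obtain ⟨B, rfl⟩ := Multiset.le_iff_exists_add.1 hc
  obtain ⟨d, rfl⟩ := (Multiset.card_eq_one (s := B)).1 (by simp at hcard; omega)
  exact ⟨c, d, rfl⟩

theorem mem_or_mem_of_le_triple {a b c d : ℂ} (ha : ‖a‖ = 1) (hb : ‖b‖ = 1) (hc : ‖c‖ = 1)
    (hsum : c + c + d = a + b) {g : Multiset ℂ} (hg : g ≤ {c, c, d}) (hga : g.sum = a) :
    (a = c ∨ a = d) ∨ (b = c ∨ b = d) := by
  have ha0 : a ≠ 0 := fun h => by simp [h] at ha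
  have hb0 : b ≠ 0 := fun h => by simp [h] at hb
  rcases le_cons_cases hg with h₁ | ⟨g₁, h₁, rfl⟩ <;>
  rcases le_cons_cases h₁ with h₂ | ⟨g₂, h₂, rfl⟩ <;>
  rw [Multiset.le_singleton] at h₂ <;>
  rcases h₂ with rfl | rfl <;>
  simp only [Multiset.sum_cons, Multiset.sum_singleton, Multiset.sum_zero] at hga
  · exact absurd hga.symm ha0
  · exact .inl (.inr hga.symm)
  · exact .inl (.inl (by linear_combination -hga))
  · exact .inr (.inl (by linear_combination hga - hsum))
  · exact .inl (.inl (by linear_combination -hga))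
  · exact .inr (.inl (by linear_combination hga - hsum))
  · exact absurd (by linear_combination hga) (two_mul_ne_of_norm ha hc)
  · exact absurd (by linear_combination hga - hsum) hb0

section Cells

variable {h : Multiset ℂ} {m p : ℕ} {η : ℂ} {f : ℕ → Multiset ℂ} {v : ℂ}

/-- Cells of weight at least two, in a sorou of weight at most 16 with `p ≥ 7`. -/
theorem IsCellDecomp.nodup_of_card_two (hd : IsCellDecomp h m p η f v)
    (hmv : IsMinVanishing h) (hm : 0 < m) (hp : 7 ≤ p) (hw : Multiset.card h ≤ 16)
    (hle : ∀ i < p, 2 ≤ Multiset.card (f i)) {i₀ : ℕ} (hi₀ : i₀ < p)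
    (hi₀2 : Multiset.card (f i₀) = 2)
    (ih : ∀ h', IsSorou h' → IsMinVanishing h' → Multiset.card h' < Multiset.card h → h'.Nodup) :
    h.Nodup := by
  have hroot : ∀ i, ∀ z ∈ f i, IsRootOfUnity z := fun i z hz => ⟨m, hm, hd.pow_eq_one i z hz⟩
  have hnorm : ∀ i, ∀ z ∈ f i, ‖z‖ = 1 := fun i z hz => (hroot i z hz).norm_eq_one
  have hcard := hd.card_eq
  obtain ⟨a, b, hab⟩ := Multiset.card_eq_two.1 hi₀2
  have haR : IsRootOfUnity a := hroot i₀ a (by simp [hab])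
  have hbR : IsRootOfUnity b := hroot i₀ b (by simp [hab])
  have ha := haR.norm_eq_one
  have hb := hbR.norm_eq_one
  have ha0 : a ≠ 0 := fun h => by simp [h] at ha
  have hb0 : b ≠ 0 := fun h => by simp [h] at hb
  have hv : v = a + b := by rw [← hd.sum_eq i₀ hi₀, hab]; simp
  have hab0 : a + b ≠ 0 := hv ▸ hd.value_ne_zero
  have hsum : ∀ i < p, (f i).sum = a + b := fun i hi => (hd.sum_eq i hi).trans hv
  have hsorou : ∀ (x : ℂ) (B : Multiset ℂ), IsRootOfUnity x → (∀ z ∈ B, IsRootOfUnity z) →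
      ∀ z ∈ -x ::ₘ B, IsRootOfUnity z := by
    intro x B hx hB z hz
    rcases Multiset.mem_cons.1 hz with rfl | hz
    · exact isRootOfUnity_neg hx
    · exact hB z hz
  obtain ⟨j, hj, hja⟩ : ∃ j < p, ∀ g ≤ f j, g.sum ≠ a := by
    by_contra! hall
    have := hd.value_eq_of_forall_exists hmv (by omega) ha0 hall
    exact hb0 (by linear_combination this - hv)
  have hjb : ∀ g ≤ f j, g.sum ≠ b := fun g hg h =>
    hja (f j - g) tsub_le_self (by rw [sum_tsub hg, hsum j hj, h]; ring)
  have hzj := hd.zeroSumFree hmv hj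
  have hj4 := two_mul_add_le_sum (fun i => Multiset.card (f i)) hle hj
  have hFj : (-a ::ₘ -b ::ₘ f j).Nodup := by
    refine ih _ ⟨Multiset.cons_ne_zero, hsorou _ _ haR (hsorou _ _ hbR (hroot j))⟩
      (hzj.isMinVanishing_cons_cons (hsum j hj) hja) ?_
    simp only [Multiset.card_cons]
    omega
  have hne : a ≠ b := by
    rintro rfl
    simp at hFj
  have hpair : ∀ i < p, Multiset.card (f i) = 2 → f i = {a, b} := by
    intro i hi h2
    obtain ⟨c, d, hcd⟩ := Multiset.card_eq_two.1 h2
    have hs : c + d = a + b := by rw [← hsum i hi, hcd]; simp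
    rw [hcd]
    rcases eq_or_eq_of_add_eq_add ha hb (hnorm i c (by simp [hcd])) (hnorm i d (by simp [hcd]))
      hs hab0 with rfl | rfl
    · rw [add_left_cancel hs]
    · rw [show d = a by linear_combination hs, Multiset.pair_comm]
  have hj3 : Multiset.card (f j) ≠ 2 := fun h2 =>
    hja {a} (by rw [hpair j hj h2]; simp) (by simp)
  refine hd.nodup (hd.ne_zero hm (by omega)) fun i hi => ?_
  by_contra hnd
  have hij : i ≠ j := by
    rintro rfl
    simp only [Multiset.nodup_cons] at hFj
    exact hnd hFj.2.2
  have hi3 : Multiset.card (f i) ≠ 2 := fun h2 => hnd (by rw [hpair i hi h2]; simpa using hne)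
  have hsum2 := two_mul_add_add_le_sum (fun i => Multiset.card (f i)) hle hi hj hij
  have hi2 := hle i hi
  have hj2 := hle j hj
  have hcj : Multiset.card (f j) = 3 := by omega
  have hci : Multiset.card (f i) = 3 := by omega
  obtain ⟨c, d, hcd⟩ := exists_eq_of_not_nodup hnd hci
  have hcR : IsRootOfUnity c := hroot i c (by simp [hcd])
  have hdR : IsRootOfUnity d := hroot i d (by simp [hcd])
  have hcds : c + c + d = a + b := by rw [← hsum i hi, hcd]; simp; ring
  have hmin : ¬ IsMinVanishing (-c ::ₘ -c ::ₘ -d ::ₘ f j) := by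
    intro hmin
    have := ih _ ⟨Multiset.cons_ne_zero,
      hsorou _ _ hcR (hsorou _ _ hcR (hsorou _ _ hdR (hroot j)))⟩ hmin
      (by simp only [Multiset.card_cons]; omega)
    simp at this
  obtain ⟨g, hg, hga⟩ : ∃ g ≤ f i, g.sum = a := by
    by_contra! hia
    have := ih _ ⟨Multiset.cons_ne_zero, hsorou _ _ haR (hsorou _ _ hbR (hroot i))⟩
      ((hd.zeroSumFree hmv hi).isMinVanishing_cons_cons (hsum i hi) hia)
      (by simp only [Multiset.card_cons]; omega)
    simp only [Multiset.nodup_cons] at this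
    exact hnd this.2.2
  have hc := hcR.norm_eq_one
  have hdn := hdR.norm_eq_one
  rcases mem_or_mem_of_le_triple ha hb hc hcds (hcd ▸ hg) hga with hac | hbc
  · exact false_of_repeated_cell hb hc hdn (hnorm j) hzj hcj (hsum j hj) hcds hja hac hmin
  · exact false_of_repeated_cell ha hc hdn (hnorm j) hzj hcj ((hsum j hj).trans (add_comm _ _))
      (hcds.trans (add_comm _ _)) hjb hbc hmin

theorem IsCellDecomp.nodup_of_seven_le (hd : IsCellDecomp h m p η f v)
    (hmv : IsMinVanishing h) (hm : 0 < m) (hp : 7 ≤ p) (hw : Multiset.card h ≤ 16)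
    (ih : ∀ h', IsSorou h' → IsMinVanishing h' → Multiset.card h' < Multiset.card h → h'.Nodup) :
    h.Nodup := by
  have hpos : ∀ i < p, Multiset.card (f i) ≠ 0 := fun i hi h0 =>
    hd.cell_ne_zero hi (Multiset.card_eq_zero.1 h0)
  by_cases h1 : ∃ i < p, Multiset.card (f i) = 1
  · obtain ⟨i, hi, h1⟩ := h1
    obtain ⟨u, hu⟩ := Multiset.card_eq_one.1 h1
    have huv := hd.sum_eq i hi
    rw [hu, Multiset.sum_singleton] at huv
    exact hd.nodup_of_isRootOfUnity hmv hm (by omega)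
      ⟨m, hm, hd.pow_eq_one i v (by rw [hu, huv]; simp)⟩ ih
  push Not at h1
  have hle : ∀ i < p, 2 ≤ Multiset.card (f i) := fun i hi => by
    have := hpos i hi
    have := h1 i hi
    omega
  obtain ⟨i, hi, hi2⟩ : ∃ i < p, Multiset.card (f i) = 2 := by
    by_contra! h2
    have : (Finset.range p).card • 3 ≤ ∑ i ∈ Finset.range p, Multiset.card (f i) :=
      Finset.card_nsmul_le_sum _ _ _ fun i hi => by
        have := hle i (Finset.mem_range.1 hi)
        have := h2 i (Finset.mem_range.1 hi)
        omega
    rw [← hd.card_eq, Finset.card_range, smul_eq_mul] at this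
    omega
  exact hd.nodup_of_card_two hmv hm hp hw hle hi hi2 ih

theorem IsCellDecomp.nodup_of_dvd_six (hd : IsCellDecomp h m p η f v)
    (hmv : IsMinVanishing h) (hm : m ∣ 6) (hp : 3 ≤ p)
    (ih : ∀ h', IsSorou h' → IsMinVanishing h' → Multiset.card h' < Multiset.card h → h'.Nodup) :
    h.Nodup := by
  obtain ⟨u, hu, hsub⟩ := exists_common_subsum hd.value_ne_zero
  have hu0 : u ≠ 0 := by rintro rfl; norm_num at hu
  have hvu : v = u := hd.value_eq_of_forall_exists hmv (by omega) hu0 fun i hi =>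
    hsub (f i) (fun z hz => by
      obtain ⟨k, hk⟩ := hm
      rw [hk, pow_mul, hd.pow_eq_one i z hz, one_pow]) (hd.zeroSumFree hmv hi) (hd.sum_eq i hi)
  exact hd.nodup_of_isRootOfUnity hmv (Nat.pos_of_dvd_of_pos hm (by norm_num)) hp
    ⟨6, by norm_num, hvu ▸ hu⟩ ih

end Cells

theorem nodup_of_sq_eq_one {h : Multiset ℂ} (h0 : h ≠ 0) (hmv : IsMinVanishing h)
    (hh : ∀ z ∈ h, z ^ 2 = 1) : h.Nodup := by
  have hmem : ∀ z ∈ h, z = 1 ∨ z = -1 := fun z hz => sq_eq_one_iff.1 (hh z hz)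
  have hrep : ∀ x : ℂ, x ≠ 0 → ¬ ∀ z ∈ h, z = x := by
    intro x hx hall
    have hs := hmv.1
    rw [Multiset.eq_replicate_card.2 hall, Multiset.sum_replicate, nsmul_eq_mul] at hs
    rcases mul_eq_zero.1 hs with hc | hc
    · exact h0 (by simpa using hc)
    · exact hx hc
  have h1 : (1 : ℂ) ∈ h := by
    by_contra h1
    exact hrep (-1) (by norm_num) fun z hz => (hmem z hz).resolve_left (by rintro rfl; exact h1 hz)
  have h2 : (-1 : ℂ) ∈ h := by
    by_contra h2
    exact hrep 1 (by norm_num) fun z hz => (hmem z hz).resolve_right (by rintro rfl; exact h2 hz)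
  have hne : (1 : ℂ) ≠ -1 := by norm_num
  have heq : {1, -1} = h := by
    by_contra hne'
    exact hmv.2 _ (pair_le hne h1 h2) (by simp) hne' (by simp)
  rw [← heq]
  simpa using hne

theorem nodup_of_reduced {h : Multiset ℂ} (h0 : h ≠ 0) (hmv : IsMinVanishing h)
    (hw : Multiset.card h ≤ 16) {n : ℕ} (hn : 0 < n) (hh : ∀ z ∈ h, z ^ n = 1)
    (hmin : ∀ c ≠ 0, ∀ k : ℕ, 0 < k → (∀ z ∈ h, (c * z) ^ k = 1) → n ≤ k)
    (ih : ∀ h', IsSorou h' → IsMinVanishing h' → Multiset.card h' < Multiset.card h → h'.Nodup) :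
    h.Nodup := by
  have hdec : ∀ p m, p.Prime → n = p * m →
      ¬ p ∣ m ∧ 0 < m ∧ ∃ η f v, IsCellDecomp h m p η f v := by
    rintro p m hp rfl
    have hm := Nat.pos_of_mul_pos_left hn
    have := exists_isCellDecomp h0 hmv hm hp hh hmin
    exact ⟨this.1, hm, this.2⟩
  by_cases hbig : ∃ p, p.Prime ∧ 7 ≤ p ∧ p ∣ n
  · obtain ⟨p, hp, hp7, m, hm⟩ := hbig
    obtain ⟨-, hm0, η, f, v, hd⟩ := hdec p m hp hm
    exact hd.nodup_of_seven_le hmv hm0 hp7 hw ih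
  push Not at hbig
  have hsq : Squarefree n := by
    rw [Nat.squarefree_iff_prime_squarefree]
    rintro p hp ⟨k, hk⟩
    exact (hdec p (p * k) hp (by rw [hk, mul_assoc])).1 (dvd_mul_right _ _)
  have h30 : n ∣ 30 := by
    rw [← Nat.prod_primeFactors_of_squarefree hsq]
    have : n.primeFactors ⊆ {2, 3, 5} := by
      intro p hp
      have hpp := Nat.prime_of_mem_primeFactors hp
      have hp7 : p < 7 := by
        by_contra hge
        exact hbig p hpp (by omega) (Nat.dvd_of_mem_primeFactors hp)
      interval_cases p <;> first | decide | norm_num at hpp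
    exact Finset.prod_dvd_prod_of_subset _ _ _ this
  by_cases h5 : 5 ∣ n
  · obtain ⟨m, hm⟩ := h5
    obtain ⟨-, -, η, f, v, hd⟩ := hdec 5 m (by norm_num) hm
    refine hd.nodup_of_dvd_six hmv ?_ (by norm_num) ih
    rw [hm] at h30
    exact Nat.dvd_of_mul_dvd_mul_left (k := 5) (by norm_num) h30
  have h6 : n ∣ 6 :=
    ((Nat.Prime.coprime_iff_not_dvd (by norm_num)).2 h5).symm.dvd_of_dvd_mul_left (m := 5) h30
  by_cases h3 : 3 ∣ n
  · obtain ⟨m, hm⟩ := h3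
    obtain ⟨-, -, η, f, v, hd⟩ := hdec 3 m (by norm_num) hm
    exact hd.nodup_of_dvd_six hmv ((Dvd.intro_left _ hm.symm).trans h6) le_rfl ih
  have h2 : n ∣ 2 :=
    ((Nat.Prime.coprime_iff_not_dvd (by norm_num)).2 h3).symm.dvd_of_dvd_mul_left (m := 3) h6
  obtain ⟨k, hk⟩ := h2
  exact nodup_of_sq_eq_one h0 hmv fun z hz => by rw [hk, pow_mul, hh z hz, one_pow]

theorem exists_common_order (h : Multiset ℂ) (hh : ∀ z ∈ h, IsRootOfUnity z) :
    ∃ n : ℕ, 0 < n ∧ ∀ z ∈ h, z ^ n = 1 := by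
  induction h using Multiset.induction_on with
  | empty => exact ⟨1, one_pos, by simp⟩
  | cons z s ih =>
    obtain ⟨n, hn, hs⟩ := ih fun y hy => hh y (Multiset.mem_cons_of_mem hy)
    obtain ⟨k, hk, hz⟩ := hh z (Multiset.mem_cons_self _ _)
    refine ⟨n * k, mul_pos hn hk, fun y hy => ?_⟩
    rcases Multiset.mem_cons.1 hy with rfl | hy
    · rw [mul_comm, pow_mul, hz, one_pow]
    · rw [pow_mul, hs y hy, one_pow]

theorem IsMinVanishing.nodup (w : ℕ) : ∀ h : Multiset ℂ, IsSorou h → IsMinVanishing h →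
    Multiset.card h = w → w ≤ 16 → h.Nodup := by
  induction w using Nat.strong_induction_on with
  | _ w ih =>
  intro h hs hmv hcard hw
  classical
  have hex : ∃ n : ℕ, 0 < n ∧ ∃ c : ℂ, c ≠ 0 ∧ ∀ z ∈ h, (c * z) ^ n = 1 := by
    obtain ⟨n, hn, hh⟩ := exists_common_order h hs.2
    exact ⟨n, hn, 1, one_ne_zero, by simpa using hh⟩
  obtain ⟨hn, c, hc, hh⟩ := Nat.find_spec hex
  refine Multiset.Nodup.of_map (c * ·) (nodup_of_reduced (by simpa using hs.1)
    (isMinVanishing_map_mul hc hmv) (by simpa [hcard] using hw) hn (by simpa using hh) ?_ ?_)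
  · intro d hd k hk hall
    refine Nat.find_min' hex ⟨hk, d * c, mul_ne_zero hd hc, fun z hz => ?_⟩
    rw [mul_assoc]
    exact hall _ (Multiset.mem_map_of_mem _ hz)
  · intro h' hs' hmv' hlt
    rw [Multiset.card_map, hcard] at hlt
    exact ih _ hlt h' hs' hmv' rfl (by omega)

theorem stmt_8 (h : Multiset ℂ) (hs : IsSorou h) (hmv : IsMinVanishing h)
    (hw : Multiset.card h ≤ 16) :
    ∀ z : ℂ, h.count z ≤ 1 :=
  Multiset.nodup_iff_count_le_one.1 (hmv.nodup _ h hs rfl hw)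
end
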